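/- arXiv:1009.4244 — 2 statements merged into one kernel-verified Lean document; each statement's English description precedes it below -/
import Mathlib

section
/- Let m ≥ 2 and let C be an algebraic curvature tensor on ℝ^m satisfying condition (T1): Sym_{(p,q,r)} Alt_{[i,j,k]} Σ_ℓ C_{ℓpqi} C_{jkrℓ} = 0. Then C satisfies condition (T2): Sym_{(p,q,r,s,t)} Alt_{[i,j,k]} Σ_{ℓ,m} ( C_{ℓpqm} C_{ℓrij} C_{kstm} − 2 C_{ℓpqi} C_{jℓrm} C_{kstm} ) = 0 if and only if C satisfies both (T5): Sym_{(p,q,r,s,t)} Alt_{[i,j,k]} Σ_{ℓ,m} C_{ℓpqm} C_{ℓrij} C_{kstm} = 0 and (T6): Sym_{(p,q,r,s,t)} Alt_{[i,j,k]} Σ_{ℓ,m} C_{ℓpqi} C_{jℓrm} C_{kstm} = 0, for all free indices. -/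
/-- An algebraic curvature tensor on `ℝ^m`. -/
def IsACT {m : ℕ} (C : Fin m → Fin m → Fin m → Fin m → ℝ) : Prop :=
  (∀ i j k l, C i j k l = - C j i k l) ∧
  (∀ i j k l, C i j k l = C k l i j) ∧
  (∀ i j k l, C i j k l + C i k l j + C i l j k = 0)

/-- Signed sum over all permutations of the three indices. -/
noncomputable def alt3 {α : Type*} (F : α → α → α → ℝ) (i j k : α) : ℝ :=
  F i j k - F i k j - F j i k + F j k i + F k i j - F k j i

/-- Sum over all permutations of the three indices. -/
noncomputable def sym3 {α : Type*} (F : α → α → α → ℝ) (p q r : α) : ℝ :=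
  F p q r + F p r q + F q p r + F q r p + F r p q + F r q p

/-- Sum over all permutations of five indices. -/
noncomputable def sym5 {m : ℕ} (F : (Fin 5 → Fin m) → ℝ) (v : Fin 5 → Fin m) : ℝ :=
  ∑ σ : Equiv.Perm (Fin 5), F (v ∘ σ)

/-- Sum over all permutations of seven indices. -/
noncomputable def sym7 {m : ℕ} (F : (Fin 7 → Fin m) → ℝ) (v : Fin 7 → Fin m) : ℝ :=
  ∑ σ : Equiv.Perm (Fin 7), F (v ∘ σ)

/-- Condition (T1): `Sym_{(p,q,r)} Alt_{[i,j,k]} Σₗ C_{ℓpqi} C_{jkrℓ} = 0`. -/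
def T1 {m : ℕ} (C : Fin m → Fin m → Fin m → Fin m → ℝ) : Prop :=
  ∀ p q r i j k : Fin m,
    sym3 (fun p' q' r' =>
      alt3 (fun i' j' k' => ∑ l, C l p' q' i' * C j' k' r' l) i j k) p q r = 0

/-- Condition (T2): `Sym_{(p,q,r,s,t)} Alt_{[i,j,k]} Σ_{ℓ,m}
( C_{ℓpqm} C_{ℓrij} C_{kstm} − 2 C_{ℓpqi} C_{jℓrm} C_{kstm} ) = 0`. -/
def T2 {m : ℕ} (C : Fin m → Fin m → Fin m → Fin m → ℝ) : Prop :=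
  ∀ p q r s t i j k : Fin m,
    sym5 (fun w =>
      alt3 (fun i' j' k' => ∑ l, ∑ a,
        (C l (w 0) (w 1) a * C l (w 2) i' j' * C k' (w 3) (w 4) a
          - 2 * C l (w 0) (w 1) i' * C j' l (w 2) a * C k' (w 3) (w 4) a)) i j k)
      ![p, q, r, s, t] = 0

/-- Condition (T5): `Sym_{(p,q,r,s,t)} Alt_{[i,j,k]} Σ_{ℓ,m} C_{ℓpqm} C_{ℓrij} C_{kstm} = 0`. -/
def T5 {m : ℕ} (C : Fin m → Fin m → Fin m → Fin m → ℝ) : Prop :=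
  ∀ p q r s t i j k : Fin m,
    sym5 (fun w =>
      alt3 (fun i' j' k' => ∑ l, ∑ a,
        C l (w 0) (w 1) a * C l (w 2) i' j' * C k' (w 3) (w 4) a) i j k)
      ![p, q, r, s, t] = 0

/-- Condition (T6): `Sym_{(p,q,r,s,t)} Alt_{[i,j,k]} Σ_{ℓ,m} C_{ℓpqi} C_{jℓrm} C_{kstm} = 0`. -/
def T6 {m : ℕ} (C : Fin m → Fin m → Fin m → Fin m → ℝ) : Prop :=
  ∀ p q r s t i j k : Fin m,
    sym5 (fun w =>
      alt3 (fun i' j' k' => ∑ l, ∑ a,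
        C l (w 0) (w 1) i' * C j' l (w 2) a * C k' (w 3) (w 4) a) i j k)
      ![p, q, r, s, t] = 0

theorem sym5_comp_perm {m : ℕ} (F : (Fin 5 → Fin m) → ℝ) (τ : Equiv.Perm (Fin 5))
    (v : Fin 5 → Fin m) :
    sym5 (fun w => F (w ∘ τ)) v = sym5 F v :=
  Equiv.sum_comp (Equiv.mulRight τ) fun σ : Equiv.Perm (Fin 5) => F (v ∘ σ)

theorem sym5_add {m : ℕ} (F G : (Fin 5 → Fin m) → ℝ) (v : Fin 5 → Fin m) :
    sym5 (fun w => F w + G w) v = sym5 F v + sym5 G v :=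
  Finset.sum_add_distrib

theorem sym5_sub {m : ℕ} (F G : (Fin 5 → Fin m) → ℝ) (v : Fin 5 → Fin m) :
    sym5 (fun w => F w - G w) v = sym5 F v - sym5 G v :=
  Finset.sum_sub_distrib ..

theorem sym5_const_mul {m : ℕ} (c : ℝ) (F : (Fin 5 → Fin m) → ℝ) (v : Fin 5 → Fin m) :
    sym5 (fun w => c * F w) v = c * sym5 F v :=
  (Finset.mul_sum ..).symm

theorem sym5_alt3 {m : ℕ} (F : Fin m → Fin m → Fin m → (Fin 5 → Fin m) → ℝ) (i j k : Fin m)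
    (v : Fin 5 → Fin m) :
    sym5 (fun w => alt3 (fun i' j' k' => F i' j' k' w) i j k) v =
      alt3 (fun i' j' k' => sym5 (F i' j' k') v) i j k := by
  simp only [alt3, sym5_add, sym5_sub]

/-- Symmetrizing over five indices absorbs a symmetrization over the first three. -/
theorem sym5_sym3 {m : ℕ} (H : Fin m → Fin m → Fin m → Fin m → Fin m → ℝ) (v : Fin 5 → Fin m) :
    sym5 (fun w => sym3 (fun p q r => H p q r (w 3) (w 4)) (w 0) (w 1) (w 2)) v =
      6 * sym5 (fun w => H (w 0) (w 1) (w 2) (w 3) (w 4)) v := by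
  have perm := fun F τ => sym5_comp_perm F τ v
  have h1 : sym5 (fun w => H (w 0) (w 2) (w 1) (w 3) (w 4)) v = _ :=
    perm (fun w => H (w 0) (w 1) (w 2) (w 3) (w 4)) (Equiv.swap 1 2)
  have h2 : sym5 (fun w => H (w 1) (w 0) (w 2) (w 3) (w 4)) v = _ :=
    perm (fun w => H (w 0) (w 1) (w 2) (w 3) (w 4)) (Equiv.swap 0 1)
  have h3 : sym5 (fun w => H (w 2) (w 1) (w 0) (w 3) (w 4)) v = _ :=
    perm (fun w => H (w 0) (w 1) (w 2) (w 3) (w 4)) (Equiv.swap 0 2)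
  have h4 : sym5 (fun w => H (w 1) (w 2) (w 0) (w 3) (w 4)) v = _ :=
    perm (fun w => H (w 0) (w 2) (w 1) (w 3) (w 4)) (Equiv.swap 0 1)
  have h5 : sym5 (fun w => H (w 2) (w 0) (w 1) (w 3) (w 4)) v = _ :=
    perm (fun w => H (w 2) (w 1) (w 0) (w 3) (w 4)) (Equiv.swap 0 1)
  simp only [sym3, sym5_add, h1, h2, h3, h4, h5]
  ring

/-- The summand of condition (T5). -/
noncomputable def term5 {m : ℕ} (C : Fin m → Fin m → Fin m → Fin m → ℝ) (i j k : Fin m)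
    (w : Fin 5 → Fin m) : ℝ :=
  ∑ l, ∑ a, C l (w 0) (w 1) a * C l (w 2) i j * C k (w 3) (w 4) a

/-- The summand of condition (T6). -/
noncomputable def term6 {m : ℕ} (C : Fin m → Fin m → Fin m → Fin m → ℝ) (i j k : Fin m)
    (w : Fin 5 → Fin m) : ℝ :=
  ∑ l, ∑ a, C l (w 0) (w 1) i * C j l (w 2) a * C k (w 3) (w 4) a

theorem IsACT.reverse {m : ℕ} {C : Fin m → Fin m → Fin m → Fin m → ℝ} (hC : IsACT C)
    (i j k l : Fin m) : C l k j i = C i j k l := by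
  linarith [hC.1 l k j i, hC.2.1 k l j i, hC.1 j i k l]

theorem sym5_term6_reverse {m : ℕ} {C : Fin m → Fin m → Fin m → Fin m → ℝ} (hC : IsACT C)
    (i j k : Fin m) (v : Fin 5 → Fin m) :
    sym5 (fun w => ∑ l, ∑ a, C l (w 0) (w 1) i * C j a (w 2) l * C k (w 3) (w 4) a) v =
      sym5 (term6 C k j i) v := by
  rw [← sym5_comp_perm (term6 C k j i) Fin.revPerm]
  congr 1
  funext w
  rw [Finset.sum_comm]
  refine Finset.sum_congr rfl fun a _ => Finset.sum_congr rfl fun l _ => ?_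
  change _ = C a (w 4) (w 3) k * C j a (w 2) l * C i (w 1) (w 0) l
  rw [hC.reverse k, hC.reverse i (w 1) (w 0) l]
  ring

/-- The contraction of condition (T1) with the Jacobi operator `C k s t a`. -/
theorem T1.sym5_term5 {m : ℕ} {C : Fin m → Fin m → Fin m → Fin m → ℝ} (hT1 : T1 C)
    (hC : IsACT C) (i j k : Fin m) (v : Fin 5 → Fin m) :
    sym5 (term5 C i j k) v = sym5 (term6 C k j i) v - sym5 (term6 C k i j) v := by
  have contracted := sym5_sym3 (fun p q r s t => ∑ a,
    alt3 (fun i' j' k' => ∑ l, C l p q i' * C j' k' r l) i j a * C k s t a) v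
  have vanish : ∀ w : Fin 5 → Fin m, sym3 (fun p q r => ∑ a,
      alt3 (fun i' j' k' => ∑ l, C l p q i' * C j' k' r l) i j a * C k (w 3) (w 4) a)
      (w 0) (w 1) (w 2) = 0 := fun w => by
    have h := fun a => hT1 (w 0) (w 1) (w 2) i j a
    simp only [sym3] at h ⊢
    simp only [← Finset.sum_add_distrib, ← add_mul, h, zero_mul, Finset.sum_const_zero]
  have expand : ∀ w : Fin 5 → Fin m, ∑ a,
      alt3 (fun i' j' k' => ∑ l, C l (w 0) (w 1) i' * C j' k' (w 2) l) i j a * C k (w 3) (w 4) a =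
      2 * ((∑ l, ∑ a, C l (w 0) (w 1) i * C j a (w 2) l * C k (w 3) (w 4) a) -
        (∑ l, ∑ a, C l (w 0) (w 1) j * C i a (w 2) l * C k (w 3) (w 4) a) - term5 C i j k w) :=
    fun w => by
    simp only [alt3, term5]
    simp only [← Finset.sum_add_distrib, ← Finset.sum_sub_distrib, Finset.mul_sum, Finset.sum_mul]
    rw [Finset.sum_comm]
    refine Finset.sum_congr rfl fun l _ => Finset.sum_congr rfl fun a _ => ?_
    have h : C l (w 2) i j = -C i j (w 2) l := by
      rw [hC.1, hC.2.1]
    rw [hC.1 a j, hC.1 a i, hC.1 j i, h]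
    ring
  simp only [vanish, expand, sym5_const_mul, sym5_sub, sym5_term6_reverse hC] at contracted
  have zero : sym5 (fun _ => (0 : ℝ)) v = 0 := Finset.sum_const_zero
  have eta : sym5 (fun w => term5 C i j k w) v = sym5 (term5 C i j k) v := rfl
  linarith

/-- For an algebraic curvature tensor on `ℝ^m` (`m ≥ 2`) satisfying the first TSN
condition (T1), the second TSN condition (T2) holds iff both (T5) and (T6) hold. -/
theorem T2_iff_T5_and_T6 {m : ℕ} (hm : 2 ≤ m)
    (C : Fin m → Fin m → Fin m → Fin m → ℝ) (hC : IsACT C)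
    (hT1 : T1 C) :
    T2 C ↔ (T5 C ∧ T6 C) := by
  have split : ∀ v i j k, sym5 (fun w => alt3 (fun i' j' k' => ∑ l, ∑ a,
        (C l (w 0) (w 1) a * C l (w 2) i' j' * C k' (w 3) (w 4) a
          - 2 * C l (w 0) (w 1) i' * C j' l (w 2) a * C k' (w 3) (w 4) a)) i j k) v =
      alt3 (fun i' j' k' => sym5 (term5 C i' j' k') v) i j k -
        2 * alt3 (fun i' j' k' => sym5 (term6 C i' j' k') v) i j k := fun v i j k => by
    simp only [← sym5_alt3, ← sym5_const_mul, ← sym5_sub]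
    congr 1
    funext w
    simp only [alt3, term5, term6, Finset.sum_sub_distrib, mul_assoc, ← Finset.mul_sum]
    ring
  have relation : ∀ v i j k, alt3 (fun i' j' k' => sym5 (term5 C i' j' k') v) i j k =
      -2 * alt3 (fun i' j' k' => sym5 (term6 C i' j' k') v) i j k := fun v i j k => by
    simp only [alt3, hT1.sym5_term5 hC]
    ring
  have h5 : T5 C ↔ ∀ p q r s t i j k : Fin m,
      alt3 (fun i' j' k' => sym5 (term5 C i' j' k') ![p, q, r, s, t]) i j k = 0 := by
    simp only [← sym5_alt3]; rfl
  have h6 : T6 C ↔ ∀ p q r s t i j k : Fin m,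
      alt3 (fun i' j' k' => sym5 (term6 C i' j' k') ![p, q, r, s, t]) i j k = 0 := by
    simp only [← sym5_alt3]; rfl
  rw [h5, h6]
  simp only [T2, split, relation]
  constructor
  · intro h
    constructor <;> intro p q r s t i j k <;> linarith [h p q r s t i j k]
  · rintro ⟨-, h⟩ p q r s t i j k
    rw [h]
    ring
end

section
/- Let m ≥ 2 and let C be an algebraic curvature tensor on ℝ^m satisfying condition (T1): Sym_{(p,q,r)} Alt_{[i,j,k]} Σ_ℓ C_{ℓpqi} C_{jkrℓ} = 0 and condition (T2): Sym_{(p,q,r,s,t)} Alt_{[i,j,k]} Σ_{ℓ,m} ( C_{ℓpqm} C_{ℓrij} C_{kstm} − 2 C_{ℓpqi} C_{jℓrm} C_{kstm} ) = 0 for all free indices. Then C satisfies (T11): Sym_{(p,q,r,s,t,u,v)} Alt_{[i,j,k]} Σ_{ℓ,m,n} C_{ℓpqm} C_{ℓrns} C_{ntij} C_{kuvm} = 0 and (T12): Sym_{(p,q,r,s,t,u,v)} Alt_{[i,j,k]} Σ_{ℓ,m,n} C_{ℓpqm} C_{nrsi} C_{jntℓ} C_{kuvm} = 0, for all free indices p,q,r,s,t,u,v,i,j,k.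 -/
open Finset Matrix

section Symmetrization

variable {n m : ℕ}

/-- The value on the diagonal at `x` of the multilinear form with coefficients `F`. -/
noncomputable def diagEval (x : Fin m → ℝ) (F : (Fin n → Fin m) → ℝ) : ℝ :=
  ∑ w : Fin n → Fin m, (∏ i, x (w i)) * F w

lemma diagEval_sub (x : Fin m → ℝ) (F G : (Fin n → Fin m) → ℝ) :
    diagEval x (fun w => F w - G w) = diagEval x F - diagEval x G := by
  simp [diagEval, mul_sub, sum_sub_distrib]

lemma diagEval_const_mul (x : Fin m → ℝ) (c : ℝ) (F : (Fin n → Fin m) → ℝ) :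
    diagEval x (fun w => c * F w) = c * diagEval x F := by
  simp only [diagEval, mul_sum]
  exact sum_congr rfl fun _ _ => by ring

lemma diagEval_sum {α : Type*} [Fintype α] (x : Fin m → ℝ) (F : α → (Fin n → Fin m) → ℝ) :
    diagEval x (fun w => ∑ a, F a w) = ∑ a, diagEval x (F a) := by
  simp only [diagEval, mul_sum]
  exact sum_comm

lemma diagEval_alt3 {α : Type*} (x : Fin m → ℝ) (F : (Fin n → Fin m) → α → α → α → ℝ) (i j k : α) :
    diagEval x (fun w => alt3 (F w) i j k) =
      alt3 (fun i j k => diagEval x (fun w => F w i j k)) i j k := by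
  simp only [alt3, diagEval, mul_sub, mul_add, sum_sub_distrib, sum_add_distrib]

lemma diagEval_comp_perm (x : Fin m → ℝ) (F : (Fin n → Fin m) → ℝ) (σ : Equiv.Perm (Fin n)) :
    diagEval x (fun w => F (w ∘ σ)) = diagEval x F := by
  refine Fintype.sum_equiv (Equiv.arrowCongr σ.symm (Equiv.refl (Fin m))) _ _ fun w => ?_
  have h : (Equiv.arrowCongr σ.symm (Equiv.refl (Fin m))) w = w ∘ σ := by
    ext i; simp [Equiv.arrowCongr]
  rw [h]
  congr 1
  exact (Equiv.prod_comp σ fun i => x (w i)).symm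

lemma diagEval_eq_zero_of_sum_perm {F : (Fin n → Fin m) → ℝ}
    (h : ∀ w : Fin n → Fin m, ∑ σ : Equiv.Perm (Fin n), F (w ∘ σ) = 0) (x : Fin m → ℝ) : diagEval x F = 0 := by
  have h0 : diagEval x (fun w => ∑ σ : Equiv.Perm (Fin n), F (w ∘ σ)) = 0 := by
    simp [diagEval, h]
  rw [diagEval_sum x fun (σ : Equiv.Perm (Fin n)) w => F (w ∘ σ)] at h0
  simp only [diagEval_comp_perm, sum_const, nsmul_eq_mul] at h0
  refine (mul_eq_zero.mp h0).resolve_left ?_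
  simp [Finset.card_univ, Fintype.card_perm, Nat.factorial_ne_zero]

/-- Polarization: a form vanishing on the diagonal has vanishing symmetrized coefficients. -/
lemma sum_perm_eq_zero_of_diagEval {F : (Fin n → Fin m) → ℝ}
    (h : ∀ x : Fin m → ℝ, diagEval x F = 0) (w : Fin n → Fin m) :
    ∑ σ : Equiv.Perm (Fin n), F (w ∘ σ) = 0 := by
  let f : (Fin m → ℝ) [×n]→L[ℝ] ℝ :=
    ∑ v : Fin n → Fin m, F v • (ContinuousMultilinearMap.mkPiAlgebra ℝ (Fin n) ℝ).compContinuousLinearMap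
      fun i => ContinuousLinearMap.proj (R := ℝ) (v i)
  have hf : ∀ y : Fin n → Fin m → ℝ, f y = ∑ v : Fin n → Fin m, F v * ∏ i, y i (v i) := by
    intro y
    simp [f]
  have hdiag : (fun x : Fin m → ℝ => f fun _ => x) = fun _ => 0 := by
    ext x
    rw [hf, ← h x]
    exact sum_congr rfl fun _ _ => mul_comm _ _
  have hbasis : ∀ v : Fin n → Fin m, (f fun i => Pi.single (v i) 1) = F v := by
    intro v
    rw [hf, sum_eq_single v]
    · simp
    · intro b _ hb
      obtain ⟨i, hi⟩ := Function.ne_iff.mp hb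
      rw [prod_eq_zero (mem_univ i), mul_zero]
      simp [hi]
    · simp
  have h0 := f.iteratedFDeriv_comp_diagonal 0 fun i => Pi.single (w i) 1
  rw [hdiag] at h0
  have h1 : ∀ σ : Equiv.Perm (Fin n), (f fun i => Pi.single (w (σ i)) 1) = F (w ∘ σ) :=
    fun σ => hbasis (w ∘ σ)
  simp only [h1] at h0
  rw [← h0]
  simp

end Symmetrization

section Trilinear

/-- If `D` is antisymmetric in its first two arguments and satisfies the cyclic identity, then the
first two conditions on `D` and `A` imply the two third-order ones. -/
lemma alt3_cube_eq_zero {V : Type*} {D : V → V → V → ℝ} {A : V → V}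
    (hanti : ∀ u v w, D u v w = -D v u w)
    (hcyc : ∀ u v w, D u v w + D v w u + D w u v = 0)
    (h1 : ∀ u v w, alt3 (fun u v w => D v w (A u)) u v w = 0)
    (h2 : ∀ u v w, alt3 (fun u v w => -D u v (A (A w)) - 2 * D v (A u) (A w)) u v w = 0)
    (u v w : V) :
    alt3 (fun u v w => D u v (A (A (A w)))) u v w = 0 ∧
      alt3 (fun u v w => D v (A u) (A (A w))) u v w = 0 := by
  have t1 : ∀ u v w, D u v (A w) + D v w (A u) + D w u (A v) = 0 := by
    intro u v w
    have := h1 u v w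
    simp only [alt3] at this
    linarith [hanti w v (A u), hanti u w (A v), hanti v u (A w)]
  have t2 : ∀ u v w, D u v (A (A w)) + D v w (A (A u)) + D w u (A (A v)) = 0 := by
    intro u v w
    have := h2 u v w
    simp only [alt3] at this
    linarith [hanti v u (A (A w)), hanti w v (A (A u)), hanti u w (A (A v)),
      hanti v (A u) (A w), hanti w (A v) (A u), hanti u (A w) (A v),
      hanti v (A w) (A u), hanti w (A u) (A v), hanti u (A v) (A w),
      hcyc u (A v) (A w), hcyc v (A w) (A u), hcyc w (A u) (A v),
      hcyc u (A w) (A v), hcyc v (A u) (A w), hcyc w (A v) (A u),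
      t1 (A u) v w, t1 u (A v) w, t1 u v (A w)]
  constructor
  · simp only [alt3]
    linarith [hanti v u (A (A (A w))), hanti w v (A (A (A u))), hanti u w (A (A (A v))),
      t2 (A u) v w, t2 u (A v) w, t2 u v (A w),
      t1 (A u) (A v) w, t1 u (A v) (A w), t1 (A u) v (A w), hcyc (A u) (A v) (A w)]
  · simp only [alt3]
    linarith [hanti v (A u) (A (A w)), hanti w (A u) (A (A v)), hanti u (A v) (A (A w)),
      hanti w (A v) (A (A u)), hanti u (A w) (A (A v)), hanti v (A w) (A (A u)),
      t1 (A u) (A v) w, t1 u (A v) (A w), t1 (A u) v (A w), hcyc (A u) (A v) (A w),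
      hcyc v (A u) (A (A w)), hcyc w (A u) (A (A v)), hcyc u (A v) (A (A w)),
      hcyc w (A v) (A (A u)), hcyc u (A w) (A (A v)), hcyc v (A w) (A (A u))]

variable {κ : Type*} [Fintype κ]

/-- The trilinear form with coefficients `T`. -/
noncomputable def trilin (T : κ → κ → κ → ℝ) (u v w : κ → ℝ) : ℝ :=
  ∑ i, ∑ j, ∑ k, u i * v j * w k * T i j k

lemma trilin_swap_left (T : κ → κ → κ → ℝ) (u v w : κ → ℝ) :
    trilin (fun i j k => T j i k) u v w = trilin T v u w := by
  simp only [trilin]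
  rw [sum_comm]
  simp only [mul_comm (v _)]

lemma trilin_swap_right (T : κ → κ → κ → ℝ) (u v w : κ → ℝ) :
    trilin (fun i j k => T i k j) u v w = trilin T u w v := by
  simp only [trilin]
  refine sum_congr rfl fun i _ => ?_
  rw [sum_comm]
  simp only [mul_right_comm (u _)]

lemma trilin_rotate (T : κ → κ → κ → ℝ) (u v w : κ → ℝ) :
    trilin (fun i j k => T j k i) u v w = trilin T v w u := by
  rw [trilin_swap_left fun i j k => T i k j, trilin_swap_right]

lemma trilin_rotate_symm (T : κ → κ → κ → ℝ) (u v w : κ → ℝ) :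
    trilin (fun i j k => T k i j) u v w = trilin T w u v := by
  rw [trilin_rotate fun i j k => T j k i, trilin_rotate]

lemma trilin_mulVec_right (A : Matrix κ κ ℝ) (T : κ → κ → κ → ℝ) (u v w : κ → ℝ) :
    trilin T u v (A *ᵥ w) = trilin (fun i j k => ∑ l, A l k * T i j l) u v w := by
  simp only [trilin, mulVec, dotProduct, mul_sum, sum_mul]
  refine sum_congr rfl fun i _ => sum_congr rfl fun j _ => ?_
  rw [sum_comm]
  exact sum_congr rfl fun _ _ => sum_congr rfl fun _ _ => by ring

lemma trilin_mulVec_middle (A : Matrix κ κ ℝ) (T : κ → κ → κ → ℝ) (u v w : κ → ℝ) :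
    trilin T u (A *ᵥ v) w = trilin (fun i j k => ∑ l, A l j * T i l k) u v w := by
  rw [← trilin_swap_right, trilin_mulVec_right, ← trilin_swap_right]

lemma trilin_alt3 (T : κ → κ → κ → ℝ) (u v w : κ → ℝ) :
    trilin (alt3 T) u v w = alt3 (trilin T) u v w := by
  have h1 := trilin_swap_right T u v w
  have h2 := trilin_swap_left T u v w
  have h3 := trilin_rotate T u v w
  have h4 := trilin_rotate_symm T u v w
  have h5 : trilin (fun i j k => T k j i) u v w = trilin T w v u := by
    rw [trilin_swap_left fun i j k => T k i j, trilin_swap_right fun i j k => T j i k,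
      trilin_swap_left]
  simp only [alt3]
  rw [← h1, ← h2, ← h3, ← h4, ← h5]
  simp only [trilin, mul_sub, mul_add, sum_sub_distrib, sum_add_distrib, alt3]

lemma trilin_single [DecidableEq κ] (T : κ → κ → κ → ℝ) (i j k : κ) :
    trilin T (Pi.single i 1) (Pi.single j 1) (Pi.single k 1) = T i j k := by
  simp [trilin, Pi.single_apply]

lemma alt3_trilin_eq_zero {T : κ → κ → κ → ℝ} (h : ∀ i j k, alt3 T i j k = 0) (u v w : κ → ℝ) :
    alt3 (trilin T) u v w = 0 := by
  rw [← trilin_alt3]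
  simp [trilin, h]

lemma alt3_eq_zero_of_trilin {T : κ → κ → κ → ℝ} (h : ∀ u v w, alt3 (trilin T) u v w = 0)
    (i j k : κ) : alt3 T i j k = 0 := by
  classical
  rw [← trilin_single (alt3 T), trilin_alt3, h]

lemma alt3_contraction_eq_zero {D : κ → κ → κ → ℝ} {A : Matrix κ κ ℝ} (hA : ∀ i j, A i j = A j i)
    (hanti : ∀ i j k, D i j k = -D j i k)
    (hcyc : ∀ i j k, D i j k + D j k i + D k i j = 0)
    (h1 : ∀ i j k, alt3 (fun i j k => ∑ l, A l i * D j k l) i j k = 0)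
    (h2 : ∀ i j k, alt3 (fun i j k => ∑ l, ∑ a,
      (A l a * -D i j l * A k a - 2 * A l i * D j l a * A k a)) i j k = 0) (i j k : κ) :
    alt3 (fun i j k => ∑ l, ∑ a, ∑ n, A l a * -A l n * -D i j n * A k a) i j k = 0 ∧
      alt3 (fun i j k => ∑ l, ∑ a, ∑ n, A l a * A n i * D j n l * A k a) i j k = 0 := by
  have e1 : trilin (fun i j k => ∑ l, A l i * D j k l) =
      fun u v w => trilin D v w (A *ᵥ u) := by
    ext u v w
    rw [trilin_mulVec_right, ← trilin_rotate _ u v w]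
  have e2 : trilin (fun i j k => ∑ l, ∑ a,
      (A l a * -D i j l * A k a - 2 * A l i * D j l a * A k a)) =
      fun u v w => -trilin D u v (A *ᵥ A *ᵥ w) - 2 * trilin D v (A *ᵥ u) (A *ᵥ w) := by
    ext u v w
    rw [trilin_mulVec_right, trilin_mulVec_right, trilin_mulVec_middle, trilin_mulVec_right,
      ← trilin_swap_left _ u v w]
    simp only [trilin, mul_sum, ← sum_neg_distrib, ← sum_sub_distrib]
    refine sum_congr rfl fun i _ => sum_congr rfl fun j _ => sum_congr rfl fun k _ => ?_
    rw [sum_comm]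
    exact sum_congr rfl fun a _ => sum_congr rfl fun l _ => by rw [hA k a]; ring
  have e3 : trilin (fun i j k => ∑ l, ∑ a, ∑ n, A l a * -A l n * -D i j n * A k a) =
      fun u v w => trilin D u v (A *ᵥ A *ᵥ A *ᵥ w) := by
    ext u v w
    rw [trilin_mulVec_right, trilin_mulVec_right, trilin_mulVec_right]
    simp only [trilin, mul_sum]
    refine sum_congr rfl fun i _ => sum_congr rfl fun j _ => sum_congr rfl fun k _ => ?_
    rw [sum_comm]
    exact sum_congr rfl fun a _ => sum_congr rfl fun l _ => sum_congr rfl fun n _ => by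
      rw [hA k a, hA l n]; ring
  have e4 : trilin (fun i j k => ∑ l, ∑ a, ∑ n, A l a * A n i * D j n l * A k a) =
      fun u v w => trilin D v (A *ᵥ u) (A *ᵥ A *ᵥ w) := by
    ext u v w
    rw [trilin_mulVec_middle, trilin_mulVec_right, trilin_mulVec_right,
      ← trilin_swap_left _ u v w]
    simp only [trilin, mul_sum]
    refine sum_congr rfl fun i _ => sum_congr rfl fun j _ => sum_congr rfl fun k _ => ?_
    rw [sum_comm]
    exact sum_congr rfl fun a _ => sum_congr rfl fun l _ => sum_congr rfl fun n _ => by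
      rw [hA k a]; ring
  have key := alt3_cube_eq_zero (D := trilin D) (A := fun u => A *ᵥ u)
    (fun u v w => by
      rw [← trilin_swap_left]
      simp only [trilin, ← sum_neg_distrib]
      exact sum_congr rfl fun i _ => sum_congr rfl fun j _ => sum_congr rfl fun k _ => by
        rw [hanti i j k]; ring)
    (fun u v w => by
      rw [← trilin_rotate D u v w, ← trilin_rotate_symm D u v w]
      simp only [trilin, ← sum_add_distrib, ← mul_add, hcyc]
      simp)
    (fun u v w => e1 ▸ alt3_trilin_eq_zero h1 u v w)
    (fun u v w => e2 ▸ alt3_trilin_eq_zero h2 u v w)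
  exact ⟨alt3_eq_zero_of_trilin (fun u v w => by rw [e3]; exact (key u v w).1) i j k,
    alt3_eq_zero_of_trilin (fun u v w => by rw [e4]; exact (key u v w).2) i j k⟩

end Trilinear

section Curvature

variable {m : ℕ}

lemma diagEval_succ {n : ℕ} (x : Fin m → ℝ) (F : (Fin (n + 1) → Fin m) → ℝ) :
    diagEval x F = ∑ p, x p * diagEval x fun w => F (vecCons p w) := by
  simp only [diagEval, mul_sum]
  rw [← (Fin.consEquiv fun _ : Fin (n + 1) => Fin m).sum_comp, Fintype.sum_prod_type]
  refine sum_congr rfl fun p _ => sum_congr rfl fun w _ => ?_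
  simp [Fin.consEquiv, Fin.prod_univ_succ, vecCons, mul_assoc]

lemma diagEval_zero (x : Fin m → ℝ) (F : (Fin 0 → Fin m) → ℝ) :
    diagEval x F = F ![] := by
  simp [diagEval, Subsingleton.elim _ ![]]

lemma diagEval_three (x : Fin m → ℝ) (f : Fin m → Fin m → ℝ) (g : Fin m → ℝ) :
    diagEval x (fun w : Fin 3 → Fin m => f (w 0) (w 1) * g (w 2)) =
      (∑ p, ∑ q, x p * x q * f p q) * ∑ r, x r * g r := by
  simp only [mul_assoc, diagEval_succ, diagEval_zero, sum_mul, ← mul_sum]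
  refine sum_congr rfl fun p _ => ?_
  simp only [mul_sum]
  refine sum_congr rfl fun q _ => sum_congr rfl fun r _ => ?_
  simp only [Matrix.cons_val]
  ring

lemma diagEval_five (x : Fin m → ℝ) (f h : Fin m → Fin m → ℝ) (g : Fin m → ℝ) :
    diagEval x (fun w : Fin 5 → Fin m => f (w 0) (w 1) * g (w 2) * h (w 3) (w 4)) =
      (∑ p, ∑ q, x p * x q * f p q) * (∑ r, x r * g r) * ∑ s, ∑ t, x s * x t * h s t := by
  simp only [mul_assoc, diagEval_succ, diagEval_zero, sum_mul, ← mul_sum]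
  refine sum_congr rfl fun p _ => ?_
  simp only [mul_sum]
  refine sum_congr rfl fun q _ => sum_congr rfl fun r _ => sum_congr rfl fun s _ =>
    sum_congr rfl fun t _ => ?_
  simp only [Matrix.cons_val]
  ring

lemma diagEval_seven (x : Fin m → ℝ) (f g k : Fin m → Fin m → ℝ) (h : Fin m → ℝ) :
    diagEval x (fun w : Fin 7 → Fin m =>
        f (w 0) (w 1) * g (w 2) (w 3) * h (w 4) * k (w 5) (w 6)) =
      (∑ p, ∑ q, x p * x q * f p q) * (∑ r, ∑ s, x r * x s * g r s) * (∑ t, x t * h t) *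
        ∑ u, ∑ v, x u * x v * k u v := by
  simp only [mul_assoc, diagEval_succ, diagEval_zero, sum_mul, ← mul_sum]
  refine sum_congr rfl fun p _ => ?_
  simp only [mul_sum]
  refine sum_congr rfl fun q _ => sum_congr rfl fun r _ => sum_congr rfl fun s _ =>
    sum_congr rfl fun t _ => sum_congr rfl fun u _ => sum_congr rfl fun v _ => ?_
  simp only [Matrix.cons_val]
  ring

lemma sym7_eq_zero_of_diagEval {F : (Fin 7 → Fin m) → ℝ} (h : ∀ x, diagEval x F = 0)
    (w : Fin 7 → Fin m) : sym7 F w = 0 :=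
  sum_perm_eq_zero_of_diagEval h w

lemma sym3_eq_sum_perm {α : Type*} (F : α → α → α → ℝ) (w : Fin 3 → α) :
    sym3 F (w 0) (w 1) (w 2) =
      ∑ σ : Equiv.Perm (Fin 3), F ((w ∘ σ) 0) ((w ∘ σ) 1) ((w ∘ σ) 2) := by
  have h : (univ : Finset (Equiv.Perm (Fin 3))) =
      {1, Equiv.swap 1 2, Equiv.swap 0 1, Equiv.swap 0 1 * Equiv.swap 1 2,
        Equiv.swap 1 2 * Equiv.swap 0 1, Equiv.swap 0 2} := by decide
  rw [h, sum_insert (by decide), sum_insert (by decide), sum_insert (by decide),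
    sum_insert (by decide), sum_insert (by decide), sum_singleton]
  simp [sym3, Equiv.swap_apply_def]
  ring

/-- The Jacobi operator `C_{ℓ x x a}`. -/
noncomputable def jacobi (C : Fin m → Fin m → Fin m → Fin m → ℝ) (x : Fin m → ℝ) :
    Matrix (Fin m) (Fin m) ℝ :=
  fun l a => ∑ p, ∑ q, x p * x q * C l p q a

/-- The contraction `C_{j k x ℓ}`. -/
noncomputable def contractThird (C : Fin m → Fin m → Fin m → Fin m → ℝ) (x : Fin m → ℝ)
    (j k l : Fin m) : ℝ :=
  ∑ r, x r * C j k r l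

variable {C : Fin m → Fin m → Fin m → Fin m → ℝ}

lemma IsACT.anti_right (hC : IsACT C) (i j k l : Fin m) : C i j k l = -C i j l k := by
  rw [hC.2.1 i j k l, hC.1 k l i j, hC.2.1 l k i j]

lemma jacobi_symm (hC : IsACT C) (x : Fin m → ℝ) (l a : Fin m) :
    jacobi C x l a = jacobi C x a l := by
  simp only [jacobi]
  rw [sum_comm]
  refine sum_congr rfl fun p _ => sum_congr rfl fun q _ => ?_
  rw [hC.2.1 l q p a, hC.1 p a l q, hC.anti_right a p l q]
  ring

lemma sum_third_fourth (hC : IsACT C) (x : Fin m → ℝ) (l n : Fin m) :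
    ∑ r, ∑ s, x r * x s * C l r n s = -jacobi C x l n := by
  simp only [jacobi, ← sum_neg_distrib]
  refine sum_congr rfl fun r _ => sum_congr rfl fun s _ => ?_
  rw [hC.anti_right l r n s]
  ring

lemma sum_second (hC : IsACT C) (x : Fin m → ℝ) (n i j : Fin m) :
    ∑ r, x r * C n r i j = -contractThird C x i j n := by
  simp only [contractThird, ← sum_neg_distrib]
  refine sum_congr rfl fun r _ => ?_
  rw [hC.2.1 n r i j, hC.anti_right i j n r]
  ring

lemma contractThird_anti (hC : IsACT C) (x : Fin m → ℝ) (i j k : Fin m) :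
    contractThird C x i j k = -contractThird C x j i k := by
  simp only [contractThird, ← sum_neg_distrib]
  refine sum_congr rfl fun r _ => ?_
  rw [hC.1 i j r k]
  ring

lemma contractThird_cyclic (hC : IsACT C) (x : Fin m → ℝ) (i j k : Fin m) :
    contractThird C x i j k + contractThird C x j k i + contractThird C x k i j = 0 := by
  simp only [contractThird, ← sum_add_distrib, ← mul_add]
  refine sum_eq_zero fun r _ => ?_
  rw [hC.2.1 i j r k, hC.2.1 j k r i, hC.2.1 k i r j]
  linear_combination x r * hC.2.2 r i j k

lemma T1.alt3_eq_zero (h : T1 C) (x : Fin m → ℝ) (i j k : Fin m) :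
    alt3 (fun i j k => ∑ l, jacobi C x l i * contractThird C x j k l) i j k = 0 := by
  have h0 := diagEval_eq_zero_of_sum_perm (F := fun w : Fin 3 → Fin m =>
    alt3 (fun i' j' k' => ∑ l, C l (w 0) (w 1) i' * C j' k' (w 2) l) i j k)
    (fun w => (sym3_eq_sum_perm _ w).symm.trans (h (w 0) (w 1) (w 2) i j k)) x
  rw [diagEval_alt3 x fun (w : Fin 3 → Fin m) i' j' k' =>
    ∑ l, C l (w 0) (w 1) i' * C j' k' (w 2) l] at h0
  rw [← h0]
  congr 1
  ext i j k
  rw [diagEval_sum x fun l (w : Fin 3 → Fin m) => C l (w 0) (w 1) i * C j k (w 2) l]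
  exact sum_congr rfl fun l _ => (diagEval_three x (fun p q => C l p q i) fun r => C j k r l).symm

lemma T2.alt3_eq_zero (hC : IsACT C) (h : T2 C) (x : Fin m → ℝ) (i j k : Fin m) :
    alt3 (fun i j k => ∑ l, ∑ a,
      (jacobi C x l a * -contractThird C x i j l * jacobi C x k a -
        2 * jacobi C x l i * contractThird C x j l a * jacobi C x k a)) i j k = 0 := by
  have h0 := diagEval_eq_zero_of_sum_perm (F := fun w : Fin 5 → Fin m =>
    alt3 (fun i' j' k' => ∑ l, ∑ a,
      (C l (w 0) (w 1) a * C l (w 2) i' j' * C k' (w 3) (w 4) a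
        - 2 * C l (w 0) (w 1) i' * C j' l (w 2) a * C k' (w 3) (w 4) a)) i j k)
    (fun w => by
      have := h (w 0) (w 1) (w 2) (w 3) (w 4) i j k
      rwa [sym5, show ![w 0, w 1, w 2, w 3, w 4] = w by ext t; fin_cases t <;> rfl] at this) x
  rw [diagEval_alt3 x fun (w : Fin 5 → Fin m) i' j' k' => ∑ l, ∑ a,
      (C l (w 0) (w 1) a * C l (w 2) i' j' * C k' (w 3) (w 4) a
        - 2 * C l (w 0) (w 1) i' * C j' l (w 2) a * C k' (w 3) (w 4) a)] at h0
  rw [← h0]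
  congr 1
  ext i j k
  rw [diagEval_sum]
  refine sum_congr rfl fun l _ => ?_
  rw [diagEval_sum]
  refine sum_congr rfl fun a _ => ?_
  simp only [mul_assoc (2 : ℝ)]
  rw [diagEval_sub, diagEval_const_mul x 2,
    diagEval_five x (fun p q => C l p q a) (fun s t => C k s t a) fun r => C l r i j,
    diagEval_five x (fun p q => C l p q i) (fun s t => C k s t a) fun r => C j l r a,
    sum_second hC]
  rfl

end Curvature

/-- If an algebraic curvature tensor on `ℝ^m` (`m ≥ 2`) satisfies the first and second
TSN conditions (T1) and (T2), then it satisfies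
(T11): `Sym_{(p,q,r,s,t,u,v)} Alt_{[i,j,k]} Σ_{ℓ,m,n} C_{ℓpqm} C_{ℓrns} C_{ntij} C_{kuvm} = 0`
and (T12): `Sym_{(p,q,r,s,t,u,v)} Alt_{[i,j,k]} Σ_{ℓ,m,n} C_{ℓpqm} C_{nrsi} C_{jntℓ} C_{kuvm} = 0`. -/
theorem T11_and_T12_from_T1_T2 {m : ℕ} (hm : 2 ≤ m)
    (C : Fin m → Fin m → Fin m → Fin m → ℝ) (hC : IsACT C)
    (hT1 : T1 C) (hT2 : T2 C) :
    (∀ p q r s t u v i j k : Fin m,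
      sym7 (fun w =>
        alt3 (fun i' j' k' => ∑ l, ∑ a, ∑ n,
          C l (w 0) (w 1) a * C l (w 2) n (w 3) * C n (w 4) i' j' * C k' (w 5) (w 6) a)
          i j k)
        ![p, q, r, s, t, u, v] = 0) ∧
    (∀ p q r s t u v i j k : Fin m,
      sym7 (fun w =>
        alt3 (fun i' j' k' => ∑ l, ∑ a, ∑ n,
          C l (w 0) (w 1) a * C n (w 2) (w 3) i' * C j' n (w 4) l * C k' (w 5) (w 6) a)
          i j k)
        ![p, q, r, s, t, u, v] = 0) := by
  have key (x : Fin m → ℝ) := alt3_contraction_eq_zero (jacobi_symm hC x)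
    (contractThird_anti hC x) (contractThird_cyclic hC x) (hT1.alt3_eq_zero x)
    (hT2.alt3_eq_zero hC x)
  constructor
  · intro p q r s t u v i j k
    refine sym7_eq_zero_of_diagEval (fun x => ?_) _
    rw [diagEval_alt3 x fun (w : Fin 7 → Fin m) i' j' k' => ∑ l, ∑ a, ∑ n,
      C l (w 0) (w 1) a * C l (w 2) n (w 3) * C n (w 4) i' j' * C k' (w 5) (w 6) a,
      ← (key x i j k).1]
    congr 1
    ext i j k
    simp only [diagEval_sum]
    refine sum_congr rfl fun l _ => sum_congr rfl fun a _ => sum_congr rfl fun n _ => ?_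
    rw [diagEval_seven x (fun p q => C l p q a) (fun r s => C l r n s) (fun u v => C k u v a)
      fun t => C n t i j, sum_third_fourth hC, sum_second hC]
    rfl
  · intro p q r s t u v i j k
    refine sym7_eq_zero_of_diagEval (fun x => ?_) _
    rw [diagEval_alt3 x fun (w : Fin 7 → Fin m) i' j' k' => ∑ l, ∑ a, ∑ n,
      C l (w 0) (w 1) a * C n (w 2) (w 3) i' * C j' n (w 4) l * C k' (w 5) (w 6) a,
      ← (key x i j k).2]
    congr 1
    ext i j k
    simp only [diagEval_sum]
    exact sum_congr rfl fun l _ => sum_congr rfl fun a _ => sum_congr rfl fun n _ =>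
      diagEval_seven x (fun p q => C l p q a) (fun r s => C n r s i) (fun u v => C k u v a)
        fun t => C j n t l
end
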